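/- arXiv:1909.10878 — 4 statements merged into one kernel-verified Lean document; each statement's English description precedes it below -/
import Mathlib

section
/- Let D be a digraph on a finite vertex set V and let α be a complex number. If D has an independent set of size k, i.e. a set S ⊆ V with |S| = k such that e(u,v) = 0 for all u, v ∈ S, then the Hermitian adjacency matrix N^α(D) has at least k non-negative eigenvalues and at least k non-positive eigenvalues (counted with multiplicity). -/
open Matrix

/-- The Hermitian adjacency matrix `N^α` of a digraph given by its
arc-multiplicity function `e` (`e u v` = number of arcs from `u` to `v`). -/
noncomputable def hermAdj {V : Type*} [Fintype V] (e : V → V → ℕ) (α : ℂ) :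
    Matrix V V ℂ :=
  Matrix.of fun u v => (e u v : ℂ) * α + (e v u : ℂ) * (starRingEnd ℂ) α

/-- If a Hermitian matrix vanishes on the square `S × S`, then at least `S.card` of its
eigenvalues are non-negative after scaling by a fixed real `s`. -/
theorem Matrix.IsHermitian.card_le_card_filter_mul_eigenvalues_nonneg {V : Type*} [Fintype V]
    [DecidableEq V] {A : Matrix V V ℂ} (hA : A.IsHermitian) (S : Finset V)
    (hS : ∀ u ∈ S, ∀ v ∈ S, A u v = 0) (s : ℝ) :
    S.card ≤ (Finset.univ.filter fun v => 0 ≤ s * hA.eigenvalues v).card := by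
  by_contra! hlt
  let U : Matrix V V ℂ := (hA.eigenvectorUnitary).1
  have hUU : U * star U = 1 := Unitary.coe_mul_star_self hA.eigenvectorUnitary
  let B : Matrix {v // 0 ≤ s * hA.eigenvalues v} S ℂ :=
    (star U).submatrix Subtype.val Subtype.val
  have hker : LinearMap.ker B.mulVecLin ≠ ⊥ := by
    apply LinearMap.ker_ne_bot_of_finrank_lt
    simpa [Fintype.card_subtype] using hlt
  obtain ⟨x, hx, hx0⟩ := Submodule.exists_mem_ne_zero_of_ne_bot hker
  let z : V → ℂ := fun v => if h : v ∈ S then x ⟨v, h⟩ else 0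
  have hz (f : V → ℂ) : ∑ v, f v * z v = ∑ v : S, f v * x v := by
    rw [← Finset.sum_subset (Finset.subset_univ S) (fun v _ hv => by simp [z, hv]),
      ← Finset.sum_coe_sort]
    exact Finset.sum_congr rfl fun v _ => by simp [z]
  let y : V → ℂ := star U *ᵥ z
  have hy (v : V) (hv : 0 ≤ s * hA.eigenvalues v) : y v = 0 :=
    (hz _).trans (congrFun (LinearMap.mem_ker.mp hx) ⟨v, hv⟩)
  have hquad : star z ⬝ᵥ A *ᵥ z = 0 := by
    refine Finset.sum_eq_zero fun u _ => ?_
    by_cases hu : u ∈ S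
    · rw [show (A *ᵥ z) u = 0 from Finset.sum_eq_zero fun v _ => ?_, mul_zero]
      by_cases hv : v ∈ S
      · simp [hS u hu v hv]
      · simp [z, hv]
    · simp [z, hu]
  have hdiag : star z ⬝ᵥ A *ᵥ z = ∑ v, ((hA.eigenvalues v * Complex.normSq (y v) : ℝ) : ℂ) := by
    have hspec : A = U * diagonal (fun v => (hA.eigenvalues v : ℂ)) * star U := by
      conv_lhs => rw [hA.spectral_theorem, Unitary.conjStarAlgAut_apply]
      rfl
    have hstar : star z ᵥ* U = star y := by
      simp [y, star_mulVec, star_eq_conjTranspose]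
    conv_lhs => rw [hspec]
    rw [← mulVec_mulVec, ← mulVec_mulVec, dotProduct_mulVec, hstar]
    refine Finset.sum_congr rfl fun v _ => ?_
    change star (y v) * (diagonal _ *ᵥ y) v = _
    rw [mulVec_diagonal]
    push_cast
    rw [Complex.normSq_eq_conj_mul_self]
    simp only [RCLike.star_def]
    ring
  have hsum : ∑ v, s * hA.eigenvalues v * Complex.normSq (y v) = 0 := by
    rw [hquad, ← Complex.ofReal_sum] at hdiag
    simp only [mul_assoc]
    rw [← Finset.mul_sum, Complex.ofReal_eq_zero.mp hdiag.symm, mul_zero]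
  have hle (v : V) : s * hA.eigenvalues v * Complex.normSq (y v) ≤ 0 := by
    by_cases hv : 0 ≤ s * hA.eigenvalues v
    · simp [hy v hv]
    · exact mul_nonpos_of_nonpos_of_nonneg (not_le.mp hv).le (Complex.normSq_nonneg _)
  have hy0 : y = 0 := by
    ext v
    by_cases hv : 0 ≤ s * hA.eigenvalues v
    · exact hy v hv
    · have := (Finset.sum_eq_zero_iff_of_nonpos fun v _ => hle v).mp hsum v (Finset.mem_univ v)
      exact Complex.normSq_eq_zero.mp ((mul_eq_zero.mp this).resolve_left (not_le.mp hv).ne)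
  have hz0 : z = 0 := by
    rw [← one_mulVec z, ← hUU, ← mulVec_mulVec]
    change U *ᵥ y = 0
    rw [hy0, mulVec_zero]
  exact hx0 (funext fun v => by simpa [z] using congrFun hz0 v)

/-- If a digraph has an independent set of size `k` (a set `S` of `k` vertices
with no arcs between any two of its members), then for every `α` the matrix
`N^α` has at least `k` non-negative eigenvalues and at least `k` non-positive
eigenvalues, counted with multiplicity. -/
theorem independent_set_eigenvalue_signs {V : Type*} [Fintype V] [DecidableEq V]
    (e : V → V → ℕ) (α : ℂ) (k : ℕ) (S : Finset V) (hcard : S.card = k)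
    (hind : ∀ u ∈ S, ∀ v ∈ S, e u v = 0)
    (hN : (hermAdj e α).IsHermitian) :
    k ≤ (Finset.univ.filter fun v => 0 ≤ hN.eigenvalues v).card ∧
    k ≤ (Finset.univ.filter fun v => hN.eigenvalues v ≤ 0).card := by
  have hS : ∀ u ∈ S, ∀ v ∈ S, hermAdj e α u v = 0 := fun u hu v hv => by
    simp [hermAdj, hind u hu v hv, hind v hv u hu]
  subst hcard
  constructor
  · simpa using hN.card_le_card_filter_mul_eigenvalues_nonneg S hS 1
  · simpa using hN.card_le_card_filter_mul_eigenvalues_nonneg S hS (-1)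
end

section
/- Let D be a bipartite digraph on n vertices and write the characteristic polynomial of M(D) as φ(M(D), ν) = Σ_{k=0}^{n} c_k ν^{n−k}. Then c_k = 0 for every odd k. -/
open Matrix

/-- The primitive sixth root of unity `ω = (1 + i√3)/2`. -/
noncomputable def omega : ℂ := (1 + Complex.I * (Real.sqrt 3 : ℂ)) / 2

/-- The Hermitian adjacency matrix of the second kind `M(D)` of a digraph given
by its arc-multiplicity function `e` (`e u v` = number of arcs from `u` to `v`):
its `(u,v)`-entry is `e(u,v)·ω + e(v,u)·conj(ω)`. -/
noncomputable def hermAdj2 {V : Type*} [Fintype V] (e : V → V → ℕ) :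
    Matrix V V ℂ :=
  Matrix.of fun u v => (e u v : ℂ) * omega + (e v u : ℂ) * (starRingEnd ℂ) omega

/-- The coefficients of the characteristic polynomial of `-A` are those of `A` up to the sign
`(-1) ^ k`, where `k` is the codegree. -/
theorem Matrix.charpoly_neg_coeff_card_sub {n R : Type*} [Fintype n] [DecidableEq n] [CommRing R]
    (A : Matrix n n R) {k : ℕ} (hk : k ≤ Fintype.card n) :
    (-A).charpoly.coeff (Fintype.card n - k) =
      (-1) ^ k * A.charpoly.coeff (Fintype.card n - k) := by
  rw [charpoly_coeff_eq_sum_minors _ _ hk, charpoly_coeff_eq_sum_minors _ _ hk]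
  congr 1
  rw [Finset.mul_sum]
  refine Finset.sum_congr rfl fun s hs => ?_
  rw [submatrix_neg, Pi.neg_apply, Pi.neg_apply, det_neg, Fintype.card_coe,
    (Finset.mem_powersetCard.mp hs).2]

/-- If the entries of `A` vanish whenever both indices lie on the same side of `p`, then `A` and
`-A` have the same characteristic polynomial. -/
theorem Matrix.charpoly_neg_of_bipartite {n R : Type*} [Fintype n] [DecidableEq n] [CommRing R]
    (A : Matrix n n R) (p : n → Prop) (hA : ∀ i j, (p i ↔ p j) → A i j = 0) :
    (-A).charpoly = A.charpoly := by
  classical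
  let d : n → R := fun i => if p i then 1 else -1
  have hd : diagonal d * diagonal d = 1 := by
    rw [diagonal_mul_diagonal, ← diagonal_one]
    congr 1
    ext i
    by_cases hi : p i <;> simp [d, hi]
  have hconj : diagonal d * (A * diagonal d) = -A := by
    ext i j
    rw [diagonal_mul, mul_diagonal, neg_apply]
    have := hA i j
    by_cases hi : p i <;> by_cases hj : p j <;> simp_all [d]
  rw [← hconj, charpoly_mul_comm, mul_assoc, hd, mul_one]

/-- If `D` is bipartite on `n` vertices and the characteristic polynomial of
`M(D)` is written as `φ(M(D), ν) = Σ_{k=0}^{n} c_k ν^{n−k}` (so that `c_k` is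
the coefficient of `ν^{n−k}`), then `c_k = 0` for every odd `k`. -/
theorem bipartite_charpoly_odd_coeff_zero {V : Type*} [Fintype V] [DecidableEq V]
    (e : V → V → ℕ) (X Y : Finset V)
    (hXY : X ∪ Y = Finset.univ) (hdisj : Disjoint X Y)
    (hX : ∀ u ∈ X, ∀ v ∈ X, e u v = 0) (hY : ∀ u ∈ Y, ∀ v ∈ Y, e u v = 0) :
    ∀ k ≤ Fintype.card V, Odd k →
      (hermAdj2 e).charpoly.coeff (Fintype.card V - k) = 0 := by
  intro k hk hodd
  have hcover : ∀ v, v ∈ X ∨ v ∈ Y := fun v =>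
    Finset.mem_union.mp (hXY ▸ Finset.mem_univ v)
  have hneg : (-hermAdj2 e).charpoly = (hermAdj2 e).charpoly := by
    refine charpoly_neg_of_bipartite _ (· ∈ X) fun u v huv => ?_
    have h0 : e u v = 0 ∧ e v u = 0 := by
      by_cases hu : u ∈ X
      · exact ⟨hX u hu v (huv.mp hu), hX v (huv.mp hu) u hu⟩
      · have hu' := (hcover u).resolve_left hu
        have hv' := (hcover v).resolve_left fun hv => hu (huv.mpr hv)
        exact ⟨hY u hu' v hv', hY v hv' u hu'⟩
    simp [hermAdj2, h0]
  have hcoeff := charpoly_neg_coeff_card_sub (hermAdj2 e) hk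
  rw [hneg, hodd.neg_one_pow, neg_one_mul] at hcoeff
  exact self_eq_neg.mp hcoeff
end

section
/- Let D be a digraph and let α = a + b·i with a, b real and a ≥ 0. Then (1/3)·ρ(N^α(D)) ≤ ν₁(N^α(D)) ≤ ρ(N^α(D)), where ν₁ is the largest eigenvalue of N^α(D) and ρ(N^α(D)) is its spectral radius. -/
open Matrix

open scoped ComplexOrder in
/-- The Rayleigh bound: the quadratic form of a Hermitian matrix is at most any upper bound of its
eigenvalues times the squared norm. -/
theorem Matrix.IsHermitian.re_dotProduct_mulVec_le {n : Type*} [Fintype n] [DecidableEq n]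
    {A : Matrix n n ℂ} (hA : A.IsHermitian) {c : ℝ} (hc : ∀ i, hA.eigenvalues i ≤ c)
    (x : n → ℂ) : (star x ⬝ᵥ A *ᵥ x).re ≤ c * ∑ i, ‖x i‖ ^ 2 := by
  have hpos : ((c : ℂ) • (1 : Matrix n n ℂ) - A).PosSemidef := by
    have hd : (diagonal fun i => ((c - hA.eigenvalues i : ℝ) : ℂ)).PosSemidef :=
      posSemidef_diagonal_iff.mpr fun i => by
        exact_mod_cast sub_nonneg.mpr (hc i)
    have h := hd.mul_mul_conjTranspose_same (hA.eigenvectorUnitary : Matrix n n ℂ)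
    convert h using 1
    have hdiag : (diagonal fun i => ((c - hA.eigenvalues i : ℝ) : ℂ)) =
        (c : ℂ) • (1 : Matrix n n ℂ) - diagonal (RCLike.ofReal ∘ hA.eigenvalues) := by
      ext i j
      by_cases hij : i = j <;> simp [hij]
    have hU : (hA.eigenvectorUnitary : Matrix n n ℂ) *
        (hA.eigenvectorUnitary : Matrix n n ℂ)ᴴ = 1 :=
      Unitary.mul_star_self_of_mem hA.eigenvectorUnitary.2
    rw [hdiag, mul_sub, sub_mul, mul_smul_comm, mul_one, smul_mul_assoc, hU]
    congr 1
    exact hA.spectral_theorem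
  have h := (Complex.le_def.mp (hpos.dotProduct_mulVec_nonneg x)).1
  have hx : (star x ⬝ᵥ x) = ((∑ i, ‖x i‖ ^ 2 : ℝ) : ℂ) := by
    simp [dotProduct, Complex.conj_mul']
  rw [sub_mulVec, dotProduct_sub, smul_mulVec, one_mulVec, dotProduct_smul, hx, smul_eq_mul,
    ← Complex.ofReal_mul, Complex.sub_re, Complex.ofReal_re, Complex.zero_re] at h
  linarith

/-- For a matrix with entries of nonnegative real part, the negated quadratic form at `x` is
controlled by its values at the conjugate of `x` and at the vector of absolute values of `x`. -/
theorem Matrix.neg_re_dotProduct_mulVec_le {n : Type*} [Fintype n] {A : Matrix n n ℂ}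
    (hA : ∀ i j, 0 ≤ (A i j).re) (x : n → ℂ) :
    -(star x ⬝ᵥ A *ᵥ x).re ≤ (star (star x) ⬝ᵥ A *ᵥ star x).re +
      2 * (star (fun i => (‖x i‖ : ℂ)) ⬝ᵥ A *ᵥ fun i => (‖x i‖ : ℂ)).re := by
  simp only [dotProduct, mulVec, Finset.mul_sum, Complex.re_sum, ← Finset.sum_neg_distrib,
    ← Finset.sum_add_distrib]
  refine Finset.sum_le_sum fun i _ => Finset.sum_le_sum fun j _ => ?_
  have hz : -(‖x i‖ * ‖x j‖) ≤ (star (x i) * x j).re := by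
    have h := neg_le_of_abs_le (Complex.abs_re_le_norm (star (x i) * x j))
    rwa [norm_mul, norm_star] at h
  have h := mul_le_mul_of_nonneg_left hz (hA i j)
  simp only [Pi.star_apply, Complex.star_def, Complex.mul_re, Complex.mul_im, Complex.conj_re,
    Complex.conj_im, Complex.ofReal_re, Complex.ofReal_im] at h ⊢
  linarith

/-- If the entries of a Hermitian matrix have nonnegative real part, every eigenvalue is at least
`-3` times any upper bound of the eigenvalues. -/
theorem Matrix.IsHermitian.neg_eigenvalues_le_three_mul {n : Type*} [Fintype n] [DecidableEq n]
    {A : Matrix n n ℂ} (hA : A.IsHermitian) (hre : ∀ i j, 0 ≤ (A i j).re) {c : ℝ}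
    (hc : ∀ i, hA.eigenvalues i ≤ c) (i : n) : -hA.eigenvalues i ≤ 3 * c := by
  set x : n → ℂ := ⇑(hA.eigenvectorBasis i) with hx
  have hnorm : ∑ j, ‖x j‖ ^ 2 = 1 := by
    rw [hx, ← EuclideanSpace.norm_sq_eq, hA.eigenvectorBasis.orthonormal.1 i, one_pow]
  have hev : hA.eigenvalues i = (star x ⬝ᵥ A *ᵥ x).re := hA.eigenvalues_eq i
  have h := neg_re_dotProduct_mulVec_le hre x
  have hconj := hA.re_dotProduct_mulVec_le hc (star x)
  have habs := hA.re_dotProduct_mulVec_le hc fun i => (‖x i‖ : ℂ)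
  simp only [Pi.star_apply, norm_star, hnorm] at hconj
  simp only [Complex.norm_real, norm_norm, hnorm] at habs
  linarith

/-- For a digraph `D` and `α = a + b·i` with `a ≥ 0`,
`(1/3)·ρ(N^α(D)) ≤ ν₁(N^α(D)) ≤ ρ(N^α(D))`, where `ν₁` is the largest
eigenvalue and `ρ` is the spectral radius (the maximum of `|λ|` over
eigenvalues `λ`). -/
theorem spectral_radius_le_three_nu_one {V : Type*} [Fintype V] [DecidableEq V]
    [Nonempty V] (e : V → V → ℕ) (a b : ℝ) (ha : 0 ≤ a)
    (α : ℂ) (hα : α = (a : ℂ) + (b : ℂ) * Complex.I)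
    (hN : (hermAdj e α).IsHermitian) :
    (1 / 3 : ℝ) * (⨆ v, |hN.eigenvalues v|) ≤ (⨆ v, hN.eigenvalues v) ∧
    (⨆ v, hN.eigenvalues v) ≤ ⨆ v, |hN.eigenvalues v| := by
  have hre : ∀ u v, 0 ≤ (hermAdj e α u v).re := by
    intro u v
    have h : (hermAdj e α u v).re = (e u v + e v u) * a := by
      simp [hermAdj, hα]
      ring
    rw [h]
    positivity
  have hle : ∀ v, hN.eigenvalues v ≤ ⨆ v, hN.eigenvalues v :=
    le_ciSup (Set.finite_range _).bddAbove
  have hneg := hN.neg_eigenvalues_le_three_mul hre hle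
  constructor
  · have h : (⨆ v, |hN.eigenvalues v|) ≤ 3 * ⨆ v, hN.eigenvalues v := by
      refine ciSup_le fun v => abs_le.mpr ⟨?_, ?_⟩ <;>
        linarith [hle v, hneg v]
    linarith
  · exact ciSup_mono (Set.finite_range _).bddAbove fun v => le_abs_self _
end

section
/- Let D be a digraph and let M = M(D) be its Hermitian adjacency matrix of the second kind. Then (1/2)·ρ(M) ≤ μ₁(D) ≤ ρ(M), where μ₁(D) is the largest eigenvalue of M and ρ(M) is its spectral radius. -/
open Matrix

open scoped ComplexOrder in
theorem Matrix.IsHermitian.posSemidef_smul_one_sub {n : Type*} [Fintype n] [DecidableEq n]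
    {A : Matrix n n ℂ} (hA : A.IsHermitian) {c : ℝ} (hc : ∀ i, hA.eigenvalues i ≤ c) :
    ((c : ℂ) • (1 : Matrix n n ℂ) - A).PosSemidef := by
  have h : (c : ℂ) • (1 : Matrix n n ℂ) - A =
      Unitary.conjStarAlgAut ℂ _ hA.eigenvectorUnitary
        (diagonal fun i => ((c - hA.eigenvalues i : ℝ) : ℂ)) := by
    have hd : (diagonal fun i => ((c - hA.eigenvalues i : ℝ) : ℂ)) =
        (c : ℂ) • (1 : Matrix n n ℂ) - diagonal (RCLike.ofReal ∘ hA.eigenvalues) := by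
      rw [smul_one_eq_diagonal, diagonal_sub]
      simp
    rw [hd, map_sub, map_smul, map_one, ← hA.spectral_theorem]
  rw [h, Unitary.conjStarAlgAut_apply]
  refine PosSemidef.mul_mul_conjTranspose_same (PosSemidef.diagonal fun i => ?_) _
  simpa [← Complex.ofReal_sub] using hc i

theorem star_dotProduct_self_eq_sum_norm_sq {n : Type*} [Fintype n] (x : n → ℂ) :
    star x ⬝ᵥ x = ((∑ i, ‖x i‖ ^ 2 : ℝ) : ℂ) := by
  simp [dotProduct, Complex.conj_mul']

theorem omega_re : omega.re = 1 / 2 := by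
  simp [omega]

theorem norm_omega : ‖omega‖ = 1 := by
  have him : omega.im = Real.sqrt 3 / 2 := by simp [omega]
  rw [← sq_eq_sq₀ (norm_nonneg _) zero_le_one, ← Complex.normSq_eq_norm_sq, Complex.normSq_apply,
    omega_re, him]
  nlinarith [Real.sq_sqrt (show (0 : ℝ) ≤ 3 by norm_num)]

theorem norm_hermAdj2_apply_le {V : Type*} [Fintype V] (e : V → V → ℕ) (u v : V) :
    ‖hermAdj2 e u v‖ ≤ 2 * (hermAdj2 e u v).re := by
  have hre : 2 * (hermAdj2 e u v).re = e u v + e v u := by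
    simp only [hermAdj2, of_apply, Complex.add_re, ← nsmul_eq_mul, Complex.re_nsmul,
      Complex.conj_re, omega_re]
    simp only [nsmul_eq_mul]
    ring
  rw [hre]
  refine (norm_add_le _ _).trans_eq ?_
  simp [norm_omega]

/-- Replacing the coordinates of a vector by their absolute values loses at most a factor `2` in
the quadratic form of `hermAdj2 e`. -/
theorem norm_dotProduct_hermAdj2_mulVec_le {V : Type*} [Fintype V] (e : V → V → ℕ) (x : V → ℂ) :
    ‖star x ⬝ᵥ hermAdj2 e *ᵥ x‖ ≤
      2 * (star (fun v => (‖x v‖ : ℂ)) ⬝ᵥ hermAdj2 e *ᵥ fun v => (‖x v‖ : ℂ)).re := by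
  simp only [dotProduct, mulVec, Finset.mul_sum, Complex.re_sum]
  refine norm_sum_le_of_le _ fun u _ => norm_sum_le_of_le _ fun v _ => ?_
  have h := mul_le_mul_of_nonneg_left (norm_hermAdj2_apply_le e u v)
    (mul_nonneg (norm_nonneg (x u)) (norm_nonneg (x v)))
  simp only [Pi.star_apply, norm_mul, Complex.star_def, RCLike.norm_conj, Complex.conj_ofReal,
    Complex.re_ofReal_mul, Complex.re_mul_ofReal]
  linarith

theorem abs_eigenvalues_hermAdj2_le {V : Type*} [Fintype V] [DecidableEq V] (e : V → V → ℕ)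
    (hM : (hermAdj2 e).IsHermitian) {c : ℝ} (hc : ∀ v, hM.eigenvalues v ≤ c) (v : V) :
    |hM.eigenvalues v| ≤ 2 * c := by
  set x : V → ℂ := ⇑(hM.eigenvectorBasis v)
  have hx : ∑ i, ‖x i‖ ^ 2 = 1 := by
    rw [← EuclideanSpace.norm_sq_eq, hM.eigenvectorBasis.norm_eq_one, one_pow]
  calc |hM.eigenvalues v|
      = |(star x ⬝ᵥ hermAdj2 e *ᵥ x).re| := by rw [hM.eigenvalues_eq v]; rfl
    _ ≤ ‖star x ⬝ᵥ hermAdj2 e *ᵥ x‖ := Complex.abs_re_le_norm _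
    _ ≤ 2 * (star (fun v => (‖x v‖ : ℂ)) ⬝ᵥ hermAdj2 e *ᵥ fun v => (‖x v‖ : ℂ)).re :=
        norm_dotProduct_hermAdj2_mulVec_le e x
    _ ≤ 2 * (c * ∑ i, ‖(‖x i‖ : ℂ)‖ ^ 2) := by gcongr; exact hM.re_dotProduct_mulVec_le hc _
    _ = 2 * c := by simp only [Complex.norm_real, norm_norm, hx, mul_one]

/-- For a digraph `D` with Hermitian adjacency matrix of the second kind
`M = M(D)`, we have `(1/2)·ρ(M) ≤ μ₁(D) ≤ ρ(M)`, where `μ₁(D)` is the largest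
eigenvalue of `M` and `ρ(M)` is its spectral radius (the maximum of `|λ|` over
eigenvalues `λ`). -/
theorem spectral_radius_le_two_mu_one {V : Type*} [Fintype V] [DecidableEq V]
    [Nonempty V] (e : V → V → ℕ) (hM : (hermAdj2 e).IsHermitian) :
    (1 / 2 : ℝ) * (⨆ v, |hM.eigenvalues v|) ≤ (⨆ v, hM.eigenvalues v) ∧
    (⨆ v, hM.eigenvalues v) ≤ ⨆ v, |hM.eigenvalues v| := by
  have hbdd (f : V → ℝ) : BddAbove (Set.range f) := (Set.finite_range f).bddAbove
  constructor
  · have h : (⨆ v, |hM.eigenvalues v|) ≤ 2 * ⨆ v, hM.eigenvalues v :=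
      ciSup_le (abs_eigenvalues_hermAdj2_le e hM (le_ciSup (hbdd _)))
    linarith
  · exact ciSup_mono (hbdd _) fun v => le_abs_self _
end
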